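/- arXiv:1809.04062 — 7 statements merged into one kernel-verified Lean document; each statement's English description precedes it below -/
import Mathlib

section
/- For every γ > 0 and every γ' ≥ C² θ^α γ, the linear map T maps the cone C⁻_γ(E) into the cone C⁻_{γ'}(F); that is, if v ∈ E satisfies ‖π₊ v‖ + ‖π₀ v‖ ≤ γ ‖π₋ v‖, then ‖π'₊ (T v)‖ + ‖π'₀ (T v)‖ ≤ γ' ‖π'₋ (T v)‖. -/
/-- **Cone invariance** under a splitting-preserving hyperbolic linear map.
With projections `π₋, π₊, π₀` on `E` (resp. `π'₋, π'₊, π'₀` on `F`) summing to the identity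
with vanishing cross-compositions, and `T : E → F` preserving the splitting, contracting by
`C θ^α` on `E₋ = range π₋` (in the sense `‖u‖ ≤ C θ^α ‖T u‖`) and bounded by `C` on
`E₊, E₀`: for every `γ > 0` and `γ' ≥ C² θ^α γ`, `T` maps the cone
`{v : ‖π₊ v‖ + ‖π₀ v‖ ≤ γ ‖π₋ v‖}` into `{w : ‖π'₊ w‖ + ‖π'₀ w‖ ≤ γ' ‖π'₋ w‖}`. -/
theorem stmt_3 {E F : Type*} [NormedAddCommGroup E] [NormedSpace ℝ E]
    [NormedAddCommGroup F] [NormedSpace ℝ F]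
    (πm πp π0 : E →ₗ[ℝ] E) (πm' πp' π0' : F →ₗ[ℝ] F)
    (hsum : πm + πp + π0 = LinearMap.id)
    (hsum' : πm' + πp' + π0' = LinearMap.id)
    (hmp : πm ∘ₗ πp = 0) (hpm : πp ∘ₗ πm = 0)
    (hm0 : πm ∘ₗ π0 = 0) (h0m : π0 ∘ₗ πm = 0)
    (hp0 : πp ∘ₗ π0 = 0) (h0p : π0 ∘ₗ πp = 0)
    (hmp' : πm' ∘ₗ πp' = 0) (hpm' : πp' ∘ₗ πm' = 0)
    (hm0' : πm' ∘ₗ π0' = 0) (h0m' : π0' ∘ₗ πm' = 0)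
    (hp0' : πp' ∘ₗ π0' = 0) (h0p' : π0' ∘ₗ πp' = 0)
    (T : E →ₗ[ℝ] F)
    (hTm : ∀ u ∈ LinearMap.range πm, T u ∈ LinearMap.range πm')
    (hTp : ∀ u ∈ LinearMap.range πp, T u ∈ LinearMap.range πp')
    (hT0 : ∀ u ∈ LinearMap.range π0, T u ∈ LinearMap.range π0')
    (C θ α : ℝ) (hC : 1 ≤ C) (hθ0 : 0 < θ) (hθ1 : θ < 1) (hα : 0 < α)
    (hboundp : ∀ u ∈ LinearMap.range πp, ‖T u‖ ≤ C * ‖u‖)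
    (hbound0 : ∀ u ∈ LinearMap.range π0, ‖T u‖ ≤ C * ‖u‖)
    (hexpand : ∀ u ∈ LinearMap.range πm, ‖u‖ ≤ C * θ ^ α * ‖T u‖)
    (γ γ' : ℝ) (hγ : 0 < γ) (hγ' : C ^ 2 * θ ^ α * γ ≤ γ')
    (v : E) (hv : ‖πp v‖ + ‖π0 v‖ ≤ γ * ‖πm v‖) :
    ‖πp' (T v)‖ + ‖π0' (T v)‖ ≤ γ' * ‖πm' (T v)‖ := by
  obtain ⟨a, ha⟩ := hTm (πm v) ⟨v, rfl⟩
  obtain ⟨b, hb⟩ := hTp (πp v) ⟨v, rfl⟩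
  obtain ⟨c, hc⟩ := hT0 (π0 v) ⟨v, rfl⟩
  have hTv : T v = πm' a + πp' b + π0' c := by
    have h := LinearMap.congr_fun hsum v
    simp only [LinearMap.add_apply, LinearMap.id_apply] at h
    rw [ha, hb, hc, ← map_add, ← map_add, h]
  have e1 : ∀ x, πm' (πp' x) = 0 := fun x => LinearMap.congr_fun hmp' x
  have e2 : ∀ x, πp' (πm' x) = 0 := fun x => LinearMap.congr_fun hpm' x
  have e3 : ∀ x, πm' (π0' x) = 0 := fun x => LinearMap.congr_fun hm0' x
  have e4 : ∀ x, π0' (πm' x) = 0 := fun x => LinearMap.congr_fun h0m' x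
  have e5 : ∀ x, πp' (π0' x) = 0 := fun x => LinearMap.congr_fun hp0' x
  have e6 : ∀ x, π0' (πp' x) = 0 := fun x => LinearMap.congr_fun h0p' x
  have s : ∀ x, πm' x + πp' x + π0' x = x := fun x => LinearMap.congr_fun hsum' x
  have i1 : πm' (πm' a) = πm' a := by simpa [e2, e4] using s (πm' a)
  have i2 : πp' (πp' b) = πp' b := by simpa [e1, e6] using s (πp' b)
  have i3 : π0' (π0' c) = π0' c := by simpa [e3, e5] using s (π0' c)
  have k1 : πm' (T v) = T (πm v) := by rw [hTv, ← ha]; simp [e1, e3, i1]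
  have k2 : πp' (T v) = T (πp v) := by rw [hTv, ← hb]; simp [e2, e5, i2]
  have k3 : π0' (T v) = T (π0 v) := by rw [hTv, ← hc]; simp [e4, e6, i3]
  rw [k1, k2, k3]
  have hC0 : 0 ≤ C := by linarith
  calc ‖T (πp v)‖ + ‖T (π0 v)‖ ≤ C * ‖πp v‖ + C * ‖π0 v‖ :=
        add_le_add (hboundp _ ⟨v, rfl⟩) (hbound0 _ ⟨v, rfl⟩)
    _ = C * (‖πp v‖ + ‖π0 v‖) := by ring
    _ ≤ C * (γ * ‖πm v‖) := by gcongr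
    _ ≤ C * (γ * (C * θ ^ α * ‖T (πm v)‖)) := by
        have := hexpand _ ⟨v, rfl⟩
        gcongr
    _ = (C ^ 2 * θ ^ α * γ) * ‖T (πm v)‖ := by ring
    _ ≤ γ' * ‖T (πm v)‖ := by gcongr
end

section
/- Let γ > 0 and γ' be such that C² θ^α γ ≤ γ' < 1. Then every v ∈ C⁻_γ(E), i.e. every v with ‖π₊ v‖ + ‖π₀ v‖ ≤ γ ‖π₋ v‖, satisfies the expansion estimate ‖T v‖ ≥ ((1 − γ') / (C (1 + γ))) θ^{−α} ‖v‖. -/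
/-- **Expansion on the stable cone.** In the setting of the abstract hyperbolic splitting,
if `C² θ^α γ ≤ γ' < 1` then every `v` in the cone `‖π₊ v‖ + ‖π₀ v‖ ≤ γ ‖π₋ v‖` satisfies
`‖T v‖ ≥ ((1 - γ')/(C(1+γ))) θ^{-α} ‖v‖`. -/
theorem stmt_4 {E F : Type*} [NormedAddCommGroup E] [NormedSpace ℝ E]
    [NormedAddCommGroup F] [NormedSpace ℝ F]
    (πm πp π0 : E →ₗ[ℝ] E) (πm' πp' π0' : F →ₗ[ℝ] F)
    (hsum : πm + πp + π0 = LinearMap.id)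
    (hsum' : πm' + πp' + π0' = LinearMap.id)
    (hmp : πm ∘ₗ πp = 0) (hpm : πp ∘ₗ πm = 0)
    (hm0 : πm ∘ₗ π0 = 0) (h0m : π0 ∘ₗ πm = 0)
    (hp0 : πp ∘ₗ π0 = 0) (h0p : π0 ∘ₗ πp = 0)
    (hmp' : πm' ∘ₗ πp' = 0) (hpm' : πp' ∘ₗ πm' = 0)
    (hm0' : πm' ∘ₗ π0' = 0) (h0m' : π0' ∘ₗ πm' = 0)
    (hp0' : πp' ∘ₗ π0' = 0) (h0p' : π0' ∘ₗ πp' = 0)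
    (T : E →ₗ[ℝ] F)
    (hTm : ∀ u ∈ LinearMap.range πm, T u ∈ LinearMap.range πm')
    (hTp : ∀ u ∈ LinearMap.range πp, T u ∈ LinearMap.range πp')
    (hT0 : ∀ u ∈ LinearMap.range π0, T u ∈ LinearMap.range π0')
    (C θ α : ℝ) (hC : 1 ≤ C) (hθ0 : 0 < θ) (hθ1 : θ < 1) (hα : 0 < α)
    (hboundp : ∀ u ∈ LinearMap.range πp, ‖T u‖ ≤ C * ‖u‖)
    (hbound0 : ∀ u ∈ LinearMap.range π0, ‖T u‖ ≤ C * ‖u‖)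
    (hexpand : ∀ u ∈ LinearMap.range πm, ‖u‖ ≤ C * θ ^ α * ‖T u‖)
    (γ γ' : ℝ) (hγ : 0 < γ) (hγ'1 : C ^ 2 * θ ^ α * γ ≤ γ') (hγ'2 : γ' < 1)
    (v : E) (hv : ‖πp v‖ + ‖π0 v‖ ≤ γ * ‖πm v‖) :
    ((1 - γ') / (C * (1 + γ))) * θ ^ (-α) * ‖v‖ ≤ ‖T v‖ := by
  have hdec : v = πm v + πp v + π0 v := by
    have h := congrArg (fun f : E →ₗ[ℝ] E => f v) hsum
    simpa using h.symm
  have hTdec : T (πm v) = T v - (T (πp v) + T (π0 v)) := by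
    have h := congrArg T hdec
    rw [map_add, map_add] at h
    rw [h]
    abel
  have h1 : ‖v‖ ≤ (1 + γ) * ‖πm v‖ := by
    have h2 : ‖πm v + πp v + π0 v‖ ≤ ‖πm v‖ + ‖πp v‖ + ‖π0 v‖ := norm_add₃_le
    rw [← hdec] at h2
    linarith
  have h3 : ‖T (πm v)‖ ≤ ‖T v‖ + (‖T (πp v)‖ + ‖T (π0 v)‖) := by
    rw [hTdec]
    exact (norm_sub_le _ _).trans (by gcongr; exact norm_add_le _ _)
  have hp := hboundp (πp v) ⟨v, rfl⟩
  have h0 := hbound0 (π0 v) ⟨v, rfl⟩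
  have hm := hexpand (πm v) ⟨v, rfl⟩
  have ht : 0 < θ ^ α := Real.rpow_pos_of_pos hθ0 α
  rw [Real.rpow_neg hθ0.le]
  set t := θ ^ α
  have hC0 : 0 < C := by linarith
  have ha := norm_nonneg (πm v)
  have h4 : ‖T (πm v)‖ ≤ ‖T v‖ + C * (γ * ‖πm v‖) := by
    have := mul_le_mul_of_nonneg_left hv hC0.le
    linarith
  have h5 : (1 - γ') * ‖πm v‖ ≤ C * t * ‖T v‖ := by
    have e1 := mul_le_mul_of_nonneg_left h4 (mul_pos hC0 ht).le
    have e2 := mul_le_mul_of_nonneg_right hγ'1 ha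
    linarith
  have h6 : (1 - γ') * ‖v‖ ≤ ‖T v‖ * (C * (1 + γ) * t) := by
    have e1 := mul_le_mul_of_nonneg_left h1 (by linarith : (0:ℝ) ≤ 1 - γ')
    have e2 := mul_le_mul_of_nonneg_left h5 (by linarith : (0:ℝ) ≤ 1 + γ)
    linarith
  have e : (1 - γ') / (C * (1 + γ)) * t⁻¹ * ‖v‖ = (1 - γ') * ‖v‖ / (C * (1 + γ) * t) := by
    field_simp
  rw [e, div_le_iff₀ (by positivity)]
  exact h6
end

section
/- Let B be a complex Banach space, let f : ℝ^d → B be a C¹ function with compact support, and let G : ℝ^d → ℝ be a C² function such that ∇G(z) ≠ 0 for every z ∈ supp f. Then ∫_{ℝ^d} e^{i G(z)} f(z) dz = i ∫_{ℝ^d} e^{i G(z)} ( Σ_{j=1}^d ∂_j ( (∂_j G(z) / |∇G(z)|²) f(z) ) ) dz, where the vector field z ↦ (∇G(z)/|∇G(z)|²) f(z) is extended by 0 outside supp f (on which extension it is C¹) and both integrals are Bochner integrals. -/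
open MeasureTheory

/-- The `j`-th partial derivative `∂_j G`. -/
noncomputable def pderiv' {d : ℕ} (G : (Fin d → ℝ) → ℝ) (i : Fin d) (z : Fin d → ℝ) : ℝ :=
  fderiv ℝ G z (Pi.single i 1)

/-- The squared Euclidean norm `|∇G(z)|²` of the gradient of `G`. -/
noncomputable def gradSq {d : ℕ} (G : (Fin d → ℝ) → ℝ) (z : Fin d → ℝ) : ℝ :=
  ∑ i, (pderiv' G i z) ^ 2

/-- The vector field `z ↦ (∇G(z)/|∇G(z)|²) f(z)` (which vanishes outside `supp f`). -/
noncomputable def hfield {d : ℕ} {B : Type*} [NormedAddCommGroup B] [NormedSpace ℝ B]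
    (G : (Fin d → ℝ) → ℝ) (f : (Fin d → ℝ) → B) (z : Fin d → ℝ) (i : Fin d) : B :=
  (pderiv' G i z / gradSq G z) • f z

/-- **Integration by parts.** If `f : ℝ^d → B` is `C¹` with compact support and
`G : ℝ^d → ℝ` is `C²` with `∇G ≠ 0` on `supp f`, then the vector field
`z ↦ (∇G(z)/|∇G(z)|²) f(z)` (extended by `0` outside `supp f`) is `C¹` and
`∫ e^{iG} f = i ∫ e^{iG} div((∇G/|∇G|²) f)`. -/
theorem stmt_5 {d : ℕ} (hd : 1 ≤ d)
    {B : Type*} [NormedAddCommGroup B] [NormedSpace ℂ B] [CompleteSpace B]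
    (f : (Fin d → ℝ) → B) (hf : ContDiff ℝ 1 f) (hfsupp : HasCompactSupport f)
    (G : (Fin d → ℝ) → ℝ) (hG : ContDiff ℝ 2 G)
    (hgrad : ∀ z ∈ tsupport f, ∃ i, pderiv' G i z ≠ 0) :
    ContDiff ℝ 1 (hfield G f) ∧
    ∫ z, Complex.exp (Complex.I * (G z : ℂ)) • f z =
      Complex.I • ∫ z, Complex.exp (Complex.I * (G z : ℂ)) •
        (∑ i, fderiv ℝ (fun w => hfield G f w i) z (Pi.single i 1)) := by
  have hp : ∀ i, ContDiff ℝ 1 (pderiv' G i) := by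
    intro i
    have h1 : ContDiff ℝ 1 (fderiv ℝ G) := hG.fderiv_right (by norm_num)
    exact h1.clm_apply contDiff_const
  have hgs : ContDiff ℝ 1 (gradSq G) := by
    unfold gradSq
    exact ContDiff.sum fun i _ => (hp i).pow 2
  have hne : ∀ z ∈ tsupport f, gradSq G z ≠ 0 := by
    intro z hz
    obtain ⟨i, hi⟩ := hgrad z hz
    have h1 : 0 < gradSq G z :=
      Finset.sum_pos' (fun j _ => sq_nonneg _) ⟨i, Finset.mem_univ i, by positivity⟩
    exact h1.ne'
  have hh : ∀ i, ContDiff ℝ 1 (fun w => hfield G f w i) := by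
    intro i
    rw [contDiff_iff_contDiffAt]
    intro z
    by_cases hz : z ∈ tsupport f
    · exact ((hp i).contDiffAt.div hgs.contDiffAt (hne z hz)).smul hf.contDiffAt
    · have h0 : (fun w => hfield G f w i) =ᶠ[nhds z] fun _ => 0 := by
        filter_upwards [notMem_tsupport_iff_eventuallyEq.mp hz] with w hw
        simp [hfield, hw]
      exact contDiffAt_const.congr_of_eventuallyEq h0
  refine ⟨contDiff_pi.mpr hh, ?_⟩
  set e : (Fin d → ℝ) → ℂ := fun z => Complex.exp (Complex.I * (G z : ℂ)) with he
  have hGd : Differentiable ℝ G := hG.differentiable (by norm_num)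
  have hed : ∀ z, HasFDerivAt e (e z • (Complex.I • (Complex.ofRealCLM.comp (fderiv ℝ G z)))) z := by
    intro z
    have h1 : HasFDerivAt (fun z => (G z : ℂ)) (Complex.ofRealCLM.comp (fderiv ℝ G z)) z :=
      Complex.ofRealCLM.hasFDerivAt.comp z (hGd z).hasFDerivAt
    exact (h1.const_mul Complex.I).cexp
  have hec : Continuous e := by
    have := hG.continuous
    fun_prop
  have hev : ∀ z i, fderiv ℝ e z (Pi.single i 1) = e z * (Complex.I * (pderiv' G i z : ℂ)) := by
    intro z i
    rw [(hed z).fderiv]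
    simp [pderiv']
  have hcs : ∀ i, HasCompactSupport (fun w => hfield G f w i) := fun i =>
    hfsupp.mono' (by
      intro z hz
      apply subset_tsupport
      intro h0
      exact hz (by simp [hfield, h0]))
  have hint1 : ∀ i, Integrable (fun z => fderiv ℝ e z (Pi.single i 1) • hfield G f z i) := by
    intro i
    simp only [hev]
    have c1 := (hp i).continuous
    have c2 := (hh i).continuous
    exact Continuous.integrable_of_hasCompactSupport (by fun_prop) (hcs i).smul_left
  have hint2 : ∀ i, Integrable
      (fun z => e z • fderiv ℝ (fun w => hfield G f w i) z (Pi.single i 1)) := by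
    intro i
    have c2 : Continuous (fderiv ℝ (fun w => hfield G f w i)) :=
      (hh i).continuous_fderiv (by norm_num)
    have c3 : HasCompactSupport
        (fun z => fderiv ℝ (fun w => hfield G f w i) z (Pi.single i 1)) :=
      (hcs i).fderiv_apply (𝕜 := ℝ) _
    exact Continuous.integrable_of_hasCompactSupport (by fun_prop) c3.smul_left
  have hint3 : ∀ i, Integrable (fun z => e z • hfield G f z i) := by
    intro i
    have c2 := (hh i).continuous
    exact Continuous.integrable_of_hasCompactSupport (by fun_prop) (hcs i).smul_left
  have key : ∀ i, ∫ z, e z • fderiv ℝ (fun w => hfield G f w i) z (Pi.single i 1) =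
      - ∫ z, fderiv ℝ e z (Pi.single i 1) • hfield G f z i := fun i =>
    integral_smul_fderiv_eq_neg_fderiv_smul_of_integrable (hint1 i) (hint2 i) (hint3 i)
      (fun z _ => (hed z).differentiableAt)
      (fun z _ => (hh i).differentiable (by norm_num) z)
  have hsum : ∀ z, ∑ i, fderiv ℝ e z (Pi.single i 1) • hfield G f z i
      = Complex.I • (e z • f z) := by
    intro z
    have h1 : ∀ i, fderiv ℝ e z (Pi.single i 1) • hfield G f z i
        = ((pderiv' G i z) ^ 2 / gradSq G z) • (Complex.I • (e z • f z)) := by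
      intro i
      rw [hev, hfield, ← Complex.coe_smul, ← Complex.coe_smul, smul_smul, smul_smul, smul_smul]
      congr 1
      push_cast
      ring
    simp only [h1]
    rw [← Finset.sum_smul, ← Finset.sum_div]
    by_cases hz : z ∈ tsupport f
    · have h2 : (∑ i, pderiv' G i z ^ 2) / gradSq G z = 1 := div_self (hne z hz)
      rw [h2, one_smul]
    · rw [image_eq_zero_of_notMem_tsupport hz]
      simp
  simp only [Finset.smul_sum]
  rw [integral_finsetSum _ (fun i _ => hint2 i)]
  simp only [key]
  rw [Finset.sum_neg_distrib, ← integral_finsetSum _ (fun i _ => hint1 i)]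
  simp only [hsum]
  rw [integral_smul, smul_neg, smul_smul, Complex.I_mul_I]
  simp
  rfl
end

section
/- Let k ≥ 1, let f : ℝ^d → ℂ be a C^k function with compact support, and let G : ℝ^d → ℝ be a C^{k+1} function with ∇G(z) ≠ 0 for all z ∈ supp f. On the open set U = {z ∈ ℝ^d : ∇G(z) ≠ 0} define recursively V₀ = f and, for 1 ≤ j ≤ k, V_j(z) = Σ_{i=1}^d ∂_i ( (∂_i G(z)/|∇G(z)|²) V_{j−1}(z) ). Then for each 0 ≤ j ≤ k there is a function f_j : U → ℂ of class C^{k−j} with supp f_j ⊆ supp f such that V_j(z) = |∇G(z)|^{−j} f_j(z) for all z ∈ U. Moreover there is a constant C ≥ 1, depending only on d and k, such that sup_{z∈U} |f_k(z)| ≤ C · M^k · ‖f‖_{C^k}, where M = sup_{z ∈ supp f} max over multi-indices γ with |γ| ≤ k of the Euclidean norm of |∇G(z)| · ∂^γ( ∇G/|∇G|² )(z), and ‖f‖_{C^k} = sup over z ∈ ℝ^d and multi-indices γ with |γ| ≤ k of |∂^γ f(z)|. -/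
open MeasureTheory

/-- The normalized gradient field `∇G/|∇G|²`. -/
noncomputable def normGrad {d : ℕ} (G : (Fin d → ℝ) → ℝ) (z : Fin d → ℝ) : Fin d → ℝ :=
  fun i => pderiv' G i z / gradSq G z

/-- The iterated integration-by-parts sequence: `V₀ = f` and
`V_j(z) = Σ_i ∂_i((∂_i G(z)/|∇G(z)|²) V_{j-1}(z))`. -/
noncomputable def Vseq {d : ℕ} (G : (Fin d → ℝ) → ℝ) (f : (Fin d → ℝ) → ℂ) :
    ℕ → (Fin d → ℝ) → ℂ
  | 0 => f
  | (j + 1) => fun z =>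
      ∑ i, fderiv ℝ (fun w => ((pderiv' G i w / gradSq G w : ℝ) : ℂ) * Vseq G f j w) z
        (Pi.single i 1)

theorem aux_pderiv {d k : ℕ} {G : (Fin d → ℝ) → ℝ} (hG : ContDiff ℝ (k + 1 : ℕ) G) (i : Fin d) :
    ContDiff ℝ k (pderiv' G i) := by
  have h : ContDiff ℝ k (fderiv ℝ G) := hG.fderiv_right (by norm_cast)
  exact h.clm_apply contDiff_const

theorem aux_gradSq {d k : ℕ} {G : (Fin d → ℝ) → ℝ} (hG : ContDiff ℝ (k + 1 : ℕ) G) :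
    ContDiff ℝ k (gradSq G) :=
  ContDiff.sum fun i _ => (aux_pderiv hG i).pow 2

theorem aux_gradSq_pos {d : ℕ} {G : (Fin d → ℝ) → ℝ} {z : Fin d → ℝ}
    (hz : ∃ i, pderiv' G i z ≠ 0) : 0 < gradSq G z := by
  obtain ⟨i, hi⟩ := hz
  exact Finset.sum_pos' (fun _ _ => sq_nonneg _) ⟨i, Finset.mem_univ _, by positivity⟩

theorem aux_isOpen {d k : ℕ} {G : (Fin d → ℝ) → ℝ} (hG : ContDiff ℝ (k + 1 : ℕ) G) :
    IsOpen {z | ∃ i, pderiv' G i z ≠ 0} := by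
  simp only [Set.ofPred_exists]
  exact isOpen_iUnion fun i => isOpen_ne_fun (aux_pderiv hG i).continuous continuous_const

theorem aux_normGrad {d k : ℕ} {G : (Fin d → ℝ) → ℝ} (hG : ContDiff ℝ (k + 1 : ℕ) G) :
    ContDiffOn ℝ k (normGrad G) {z | ∃ i, pderiv' G i z ≠ 0} := by
  rw [contDiffOn_pi]
  intro i
  exact (aux_pderiv hG i).contDiffOn.div (aux_gradSq hG).contDiffOn
    fun z hz => (aux_gradSq_pos hz).ne'

theorem aux_Vsucc {d : ℕ} (G : (Fin d → ℝ) → ℝ) (f : (Fin d → ℝ) → ℂ) (j : ℕ) :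
    Vseq G f (j + 1) = fun z => ∑ i, fderiv ℝ (fun w => normGrad G w i • Vseq G f j w) z
        (Pi.single i 1) := by
  funext z
  simp only [Vseq, normGrad, Complex.real_smul]

theorem aux_V_contDiff {d k : ℕ} {G : (Fin d → ℝ) → ℝ} {f : (Fin d → ℝ) → ℂ}
    (hf : ContDiff ℝ k f) (hG : ContDiff ℝ (k + 1 : ℕ) G) (j : ℕ) (hj : j ≤ k) :
    ContDiffOn ℝ (k - j : ℕ) (Vseq G f j) {z | ∃ i, pderiv' G i z ≠ 0} := by
  induction j with
  | zero => exact hf.contDiffOn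
  | succ j ih =>
    rw [aux_Vsucc]
    refine ContDiffOn.sum fun i _ => ?_
    have h1 : ContDiffOn ℝ (k - j : ℕ) (fun w => normGrad G w i • Vseq G f j w)
        {z | ∃ i, pderiv' G i z ≠ 0} := by
      have h0 : ContDiffOn ℝ (k - j : ℕ) (fun w => normGrad G w i)
          {z | ∃ i, pderiv' G i z ≠ 0} := ((contDiffOn_pi.1 (aux_normGrad hG)) i).of_le (by norm_cast; omega)
      exact h0.smul (ih (by omega))
    have h2 : ContDiffOn ℝ (k - (j + 1) : ℕ)
        (fderiv ℝ (fun w => normGrad G w i • Vseq G f j w))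
        {z | ∃ i, pderiv' G i z ≠ 0} :=
      h1.fderiv_of_isOpen (aux_isOpen hG) (by norm_cast; omega)
    exact h2.clm_apply contDiffOn_const

theorem aux_V_tsupport {d : ℕ} (G : (Fin d → ℝ) → ℝ) (f : (Fin d → ℝ) → ℂ) (j : ℕ) :
    tsupport (Vseq G f j) ⊆ tsupport f := by
  induction j with
  | zero => exact subset_rfl
  | succ j ih =>
    refine closure_minimal ?_ (isClosed_tsupport f)
    intro z hz
    by_contra hzf
    apply hz
    rw [aux_Vsucc]
    refine Finset.sum_eq_zero fun i _ => ?_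
    rw [fderiv_of_notMem_tsupport]
    · rfl
    · exact fun h => hzf (ih (tsupport_smul_subset_right _ _ h))

theorem aux_bound {d k : ℕ} {G : (Fin d → ℝ) → ℝ} {f : (Fin d → ℝ) → ℂ}
    (hf : ContDiff ℝ k f) (hG : ContDiff ℝ (k + 1 : ℕ) G) {z : Fin d → ℝ}
    (hz : ∃ i, pderiv' G i z ≠ 0) {A N : ℝ} (hA : 0 ≤ A) (hN : 0 ≤ N)
    (hGA : ∀ m ≤ k, ‖iteratedFDeriv ℝ m (normGrad G) z‖ ≤ A)
    (hfN : ∀ m ≤ k, ‖iteratedFDeriv ℝ m f z‖ ≤ N) (j : ℕ) :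
    ∀ m, m + j ≤ k → ‖iteratedFDeriv ℝ m (Vseq G f j) z‖ ≤ (d * 2 ^ k * A) ^ j * N := by
  induction j with
  | zero => intro m hm; simpa [Vseq] using hfN m (by omega)
  | succ j ih =>
    intro m hm
    have hU := aux_isOpen hG
    have hzU : z ∈ {z | ∃ i, pderiv' G i z ≠ 0} := hz
    have hn (i : Fin d) : ContDiffOn ℝ (m + 1 : ℕ) (fun w => normGrad G w i)
        {z | ∃ i, pderiv' G i z ≠ 0} :=
      ((contDiffOn_pi.1 (aux_normGrad hG)) i).of_le (by norm_cast; omega)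
    have hV : ContDiffOn ℝ (m + 1 : ℕ) (Vseq G f j) {z | ∃ i, pderiv' G i z ≠ 0} :=
      (aux_V_contDiff hf hG j (by omega)).of_le (by norm_cast; omega)
    have hF (i : Fin d) : ContDiffAt ℝ m
        (fderiv ℝ (fun w => normGrad G w i • Vseq G f j w)) z :=
      (((hn i).smul hV).contDiffAt (hU.mem_nhds hzU)).fderiv_right (by norm_cast)
    have key (i : Fin d) :
        ‖iteratedFDeriv ℝ (m + 1) (fun w => normGrad G w i • Vseq G f j w) z‖ ≤
          2 ^ k * A * ((d * 2 ^ k * A) ^ j * N) := by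
      rw [← iteratedFDerivWithin_of_isOpen (m + 1) hU hzU]
      refine (norm_iteratedFDerivWithin_smul_le (hn i) hV hU.uniqueDiffOn hzU le_rfl).trans ?_
      have hstep : ∀ l ∈ Finset.range (m + 1 + 1), ((m + 1).choose l : ℝ) *
          ‖iteratedFDerivWithin ℝ l (fun w => normGrad G w i) {z | ∃ i, pderiv' G i z ≠ 0} z‖ *
          ‖iteratedFDerivWithin ℝ (m + 1 - l) (Vseq G f j) {z | ∃ i, pderiv' G i z ≠ 0} z‖ ≤
          ((m + 1).choose l : ℝ) * (A * ((d * 2 ^ k * A) ^ j * N)) := by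
        intro l hl
        rw [Finset.mem_range] at hl
        rw [iteratedFDerivWithin_of_isOpen _ hU hzU, iteratedFDerivWithin_of_isOpen _ hU hzU,
          mul_assoc]
        have h1 : ‖iteratedFDeriv ℝ l (fun w => normGrad G w i) z‖ ≤ A := by
          have h2 := ContinuousLinearMap.norm_iteratedFDeriv_comp_left
            (ContinuousLinearMap.proj (R := ℝ) (φ := fun _ : Fin d => ℝ) i)
            (n := l) ((aux_normGrad hG).contDiffAt (hU.mem_nhds hzU)) (by norm_cast; omega)
          refine le_trans h2 ?_
          have h3 : ‖ContinuousLinearMap.proj (R := ℝ) (φ := fun _ : Fin d => ℝ) i‖ ≤ 1 :=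
            ContinuousLinearMap.opNorm_le_bound _ zero_le_one fun x => by
              simpa using norm_le_pi_norm x i
          calc _ ≤ 1 * A := mul_le_mul h3 (hGA l (by omega)) (norm_nonneg _) zero_le_one
            _ = A := one_mul A
        gcongr
        exact ih _ (by omega)
      refine (Finset.sum_le_sum hstep).trans ?_
      rw [← Finset.sum_mul, ← Nat.cast_sum, Nat.sum_range_choose, mul_assoc (2 ^ k : ℝ) A]
      push_cast
      gcongr
      · norm_num
      · omega
    rw [aux_Vsucc, iteratedFDeriv_fun_sum_apply fun i _ => (hF i).clm_apply contDiffAt_const]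
    calc _ ≤ ∑ i : Fin d, (2 ^ k * A * ((d * 2 ^ k * A) ^ j * N)) := by
          refine norm_sum_le_of_le _ fun i _ => ?_
          refine (norm_iteratedFDeriv_clm_apply_const (hF i) le_rfl).trans ?_
          rw [norm_iteratedFDeriv_fderiv, Pi.norm_single, norm_one, one_mul]
          exact key i
      _ = _ := by
          rw [Finset.sum_const, Finset.card_univ, Fintype.card_fin, nsmul_eq_mul]
          ring

/-- **Iterated integration by parts.** For `f ∈ C^k` with compact support and `G ∈ C^{k+1}`
with `∇G ≠ 0` on `supp f`, each `V_j` equals `|∇G|^{-j} f_j` on `U = {∇G ≠ 0}` with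
`f_j ∈ C^{k-j}(U)`, `supp f_j ⊆ supp f`, and `sup_U |f_k| ≤ C M^k ‖f‖_{C^k}` for a constant
`C ≥ 1` depending only on `d` and `k`, where `M` bounds
`|∇G| · ‖∂^γ(∇G/|∇G|²)‖` (all orders `≤ k`) on `supp f` and `N` bounds `‖f‖_{C^k}`. -/
theorem stmt_6 {d : ℕ} (hd : 1 ≤ d) (k : ℕ) (hk : 1 ≤ k) :
    ∃ C : ℝ, 1 ≤ C ∧
      ∀ (f : (Fin d → ℝ) → ℂ) (G : (Fin d → ℝ) → ℝ),
        ContDiff ℝ k f → HasCompactSupport f → ContDiff ℝ (k + 1 : ℕ) G →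
        (∀ z ∈ tsupport f, ∃ i, pderiv' G i z ≠ 0) →
        ∀ M N : ℝ, 0 ≤ M → 0 ≤ N →
        (∀ z ∈ tsupport f, ∀ m ≤ k,
          Real.sqrt (gradSq G z) * ‖iteratedFDeriv ℝ m (normGrad G) z‖ ≤ M) →
        (∀ (z : Fin d → ℝ), ∀ m ≤ k, ‖iteratedFDeriv ℝ m f z‖ ≤ N) →
        ∃ fj : ℕ → (Fin d → ℝ) → ℂ,
          (∀ j ≤ k,
            ContDiffOn ℝ (k - j : ℕ) (fj j) {z | ∃ i, pderiv' G i z ≠ 0} ∧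
            tsupport (fj j) ⊆ tsupport f ∧
            ∀ z ∈ {z | ∃ i, pderiv' G i z ≠ 0},
              Vseq G f j z = fj j z / ((Real.sqrt (gradSq G z) ^ j : ℝ) : ℂ)) ∧
          ∀ z ∈ {z | ∃ i, pderiv' G i z ≠ 0}, ‖fj k z‖ ≤ C * M ^ k * N := by
  refine ⟨(d * 2 ^ k) ^ k, ?_, ?_⟩
  · have h1 : (1 : ℝ) ≤ d := by exact_mod_cast hd
    exact one_le_pow₀ (one_le_mul_of_one_le_of_one_le h1 (one_le_pow₀ one_le_two))
  intro f G hf _ hG hGf M N hM hN hGM hfN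
  have hs {z : Fin d → ℝ} (hz : ∃ i, pderiv' G i z ≠ 0) : 0 < Real.sqrt (gradSq G z) :=
    Real.sqrt_pos.2 (aux_gradSq_pos hz)
  refine ⟨fun j z => (Real.sqrt (gradSq G z) ^ j) • Vseq G f j z, ?_, ?_⟩
  · intro j hj
    refine ⟨?_, ?_, ?_⟩
    · have h0 : ContDiffOn ℝ (k - j : ℕ) (fun z => Real.sqrt (gradSq G z))
          {z | ∃ i, pderiv' G i z ≠ 0} := ((aux_gradSq hG).contDiffOn.of_le (by norm_cast; omega)).sqrt
        fun z hz => (aux_gradSq_pos hz).ne'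
      exact (h0.pow j).smul (aux_V_contDiff hf hG j hj)
    · exact (tsupport_smul_subset_right _ _).trans (aux_V_tsupport G f j)
    · intro z hz
      have h : ((Real.sqrt (gradSq G z) ^ j : ℝ) : ℂ) ≠ 0 :=
        Complex.ofReal_ne_zero.2 (pow_pos (hs hz) j).ne'
      simp only [Complex.real_smul]
      rw [mul_div_cancel_left₀ _ h]
  · intro z hz
    by_cases hzf : z ∈ tsupport f
    · have hsz := hs hz
      have hb := aux_bound hf hG hz (A := M / Real.sqrt (gradSq G z)) (by positivity) hN
        (fun m hm => by
          rw [le_div_iff₀ hsz, mul_comm]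
          exact hGM z hzf m hm)
        (fun m hm => hfN z m hm) k 0 (by omega)
      rw [norm_iteratedFDeriv_zero] at hb
      rw [norm_smul, Real.norm_of_nonneg (by positivity)]
      calc _ ≤ Real.sqrt (gradSq G z) ^ k *
            ((d * 2 ^ k * (M / Real.sqrt (gradSq G z))) ^ k * N) := by gcongr
        _ = (Real.sqrt (gradSq G z) * (d * 2 ^ k * (M / Real.sqrt (gradSq G z)))) ^ k * N := by
            rw [mul_pow (Real.sqrt (gradSq G z))]; ring
        _ = (d * 2 ^ k * M) ^ k * N := by
            congr 2
            field_simp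
        _ = _ := by rw [mul_pow _ M]
    · have h0 : Vseq G f k z = 0 :=
        image_eq_zero_of_notMem_tsupport fun h => hzf (aux_V_tsupport G f k h)
      simp only [h0, smul_zero, norm_zero]
      positivity
end

section
/- Let τ be a pointwise renormalization time and assume that for every α ∈ ℝ and every x ∈ M the function ρ ↦ τ ρ α x is differentiable on ℝ. Then for all ρ, α ∈ ℝ and all x ∈ M, the derivative satisfies ∂_ρ τ (ρ, α, x) = ∂_ρ τ (0, α, h ρ x), where ∂_ρ τ (ρ₀, α, y) denotes the derivative of the function ρ ↦ τ ρ α y at the point ρ₀. -/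
/-- **Derivative shift formula:** if `ρ ↦ τ ρ α x` is differentiable, then
`∂_ρ τ (ρ, α, x) = ∂_ρ τ (0, α, h ρ x)`. -/
theorem stmt_14 {M : Type*} (g h : ℝ → M → M)
    (hg0 : ∀ x, g 0 x = x) (hgadd : ∀ α₁ α₂ x, g (α₁ + α₂) x = g α₁ (g α₂ x))
    (hh0 : ∀ x, h 0 x = x) (hhadd : ∀ ρ₁ ρ₂ x, h (ρ₁ + ρ₂) x = h ρ₁ (h ρ₂ x))
    (hinj : ∀ x, Function.Injective (fun ρ => h ρ x))
    (τ : ℝ → ℝ → M → ℝ)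
    (hτ : ∀ ρ α x, g α (h ρ x) = h (τ ρ α x) (g α x))
    (hdiff : ∀ α x, Differentiable ℝ (fun ρ => τ ρ α x)) :
    ∀ ρ α x, deriv (fun ρ' => τ ρ' α x) ρ = deriv (fun ρ' => τ ρ' α (h ρ x)) 0 := by
  intro ρ α x
  have key : ∀ s, τ s α (h ρ x) = τ (s + ρ) α x - τ ρ α x := by
    intro s
    have e : τ (s + ρ) α x = τ s α (h ρ x) + τ ρ α x := by
      apply hinj (g α x)
      show h (τ (s + ρ) α x) (g α x) = h (τ s α (h ρ x) + τ ρ α x) (g α x)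
      rw [← hτ, hhadd, hhadd, hτ s α (h ρ x), hτ ρ α x]
    linarith
  have hf : (fun ρ' => τ ρ' α (h ρ x)) = fun s => τ (s + ρ) α x - τ ρ α x := funext key
  rw [hf, deriv_sub_const, deriv_comp_add_const (fun ρ' => τ ρ' α x) ρ 0, zero_add]
end

section
/- Let τ be a pointwise renormalization time and assume that for every α ∈ ℝ and every x ∈ M the function ρ ↦ τ ρ α x is differentiable at ρ = 0. Then for all α₁, α₂ ∈ ℝ and all x ∈ M the derivatives satisfy the multiplicative cocycle identity ∂_ρ τ (0, α₁, g α₂ x) · ∂_ρ τ (0, α₂, x) = ∂_ρ τ (0, α₁+α₂, x), where ∂_ρ τ (0, α, y) denotes the derivative of ρ ↦ τ ρ α y at 0. -/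
/-- **Multiplicative cocycle identity of the horocyclic derivative:**
`∂_ρ τ (0, α₁, g α₂ x) · ∂_ρ τ (0, α₂, x) = ∂_ρ τ (0, α₁+α₂, x)`. -/
theorem stmt_15 {M : Type*} (g h : ℝ → M → M)
    (hg0 : ∀ x, g 0 x = x) (hgadd : ∀ α₁ α₂ x, g (α₁ + α₂) x = g α₁ (g α₂ x))
    (hh0 : ∀ x, h 0 x = x) (hhadd : ∀ ρ₁ ρ₂ x, h (ρ₁ + ρ₂) x = h ρ₁ (h ρ₂ x))
    (hinj : ∀ x, Function.Injective (fun ρ => h ρ x))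
    (τ : ℝ → ℝ → M → ℝ)
    (hτ : ∀ ρ α x, g α (h ρ x) = h (τ ρ α x) (g α x))
    (hdiff : ∀ α x, DifferentiableAt ℝ (fun ρ => τ ρ α x) 0) :
    ∀ α₁ α₂ x,
      deriv (fun ρ => τ ρ α₁ (g α₂ x)) 0 * deriv (fun ρ => τ ρ α₂ x) 0 =
        deriv (fun ρ => τ ρ (α₁ + α₂) x) 0 := by
  intro α₁ α₂ x
  have h0 : τ 0 α₂ x = 0 := by
    apply hinj (g α₂ x)
    show h (τ 0 α₂ x) (g α₂ x) = h 0 (g α₂ x)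
    rw [← hτ, hh0, hh0]
  have hcomp : (fun ρ => τ ρ (α₁ + α₂) x)
      = (fun ρ => τ ρ α₁ (g α₂ x)) ∘ (fun ρ => τ ρ α₂ x) := by
    funext ρ
    apply hinj (g (α₁ + α₂) x)
    show h (τ ρ (α₁ + α₂) x) (g (α₁ + α₂) x)
      = h (τ (τ ρ α₂ x) α₁ (g α₂ x)) (g (α₁ + α₂) x)
    rw [← hτ, hgadd, hgadd, ← hτ, ← hτ]
  have hd : HasDerivAt (fun ρ => τ ρ α₁ (g α₂ x))
      (deriv (fun ρ => τ ρ α₁ (g α₂ x)) 0) (τ 0 α₂ x) := by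
    rw [h0]
    exact (hdiff α₁ (g α₂ x)).hasDerivAt
  rw [hcomp]
  exact (HasDerivAt.comp (0 : ℝ) hd (hdiff α₂ x).hasDerivAt).deriv.symm
end

section
/- Let τ be a pointwise renormalization time, let α ∈ ℝ and x ∈ M, and assume that for every y ∈ M the function ρ ↦ τ ρ α y is differentiable on ℝ and that the function s ↦ ∂_ρ τ (0, α, h s x) is continuous on ℝ. Then for every ρ ∈ ℝ the renormalization time is recovered as the integral of its horocyclic derivative along the h-orbit: τ ρ α x = ∫_0^ρ ∂_ρ τ (0, α, h s x) ds, where ∂_ρ τ (0, α, y) denotes the derivative of ρ ↦ τ ρ α y at 0. -/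
/-- **The renormalization time as a horocycle integral of its derivative:**
`τ ρ α x = ∫_0^ρ ∂_ρ τ (0, α, h s x) ds`. -/
theorem stmt_16 {M : Type*} (g h : ℝ → M → M)
    (hg0 : ∀ x, g 0 x = x) (hgadd : ∀ α₁ α₂ x, g (α₁ + α₂) x = g α₁ (g α₂ x))
    (hh0 : ∀ x, h 0 x = x) (hhadd : ∀ ρ₁ ρ₂ x, h (ρ₁ + ρ₂) x = h ρ₁ (h ρ₂ x))
    (hinj : ∀ x, Function.Injective (fun ρ => h ρ x))
    (τ : ℝ → ℝ → M → ℝ)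
    (hτ : ∀ ρ α x, g α (h ρ x) = h (τ ρ α x) (g α x))
    (α : ℝ) (x : M)
    (hdiff : ∀ y, Differentiable ℝ (fun ρ => τ ρ α y))
    (hcont : Continuous (fun s : ℝ => deriv (fun ρ' => τ ρ' α (h s x)) 0)) :
    ∀ ρ : ℝ, τ ρ α x = ∫ s in (0 : ℝ)..ρ, deriv (fun ρ' => τ ρ' α (h s x)) 0 := by
  intro ρ
  have hcoc : ∀ r s : ℝ, τ (r + s) α x = τ r α (h s x) + τ s α x := by
    intro r s
    apply hinj (g α x)
    change h (τ (r + s) α x) (g α x) = h (τ r α (h s x) + τ s α x) (g α x)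
    rw [← hτ, hhadd, hτ, hτ s, hhadd]
  have h0 : τ 0 α x = 0 := by
    have := hcoc 0 0
    rw [hh0, add_zero] at this
    linarith
  have hd : ∀ s : ℝ, HasDerivAt (fun ρ => τ ρ α x)
      (deriv (fun ρ' => τ ρ' α (h s x)) 0) s := by
    intro s
    have h1 : HasDerivAt (fun r => τ r α (h s x))
        (deriv (fun ρ' => τ ρ' α (h s x)) 0) (s - s) := by
      rw [sub_self]
      exact ((hdiff (h s x)) 0).hasDerivAt
    have h2 := (h1.comp_sub_const s s).add_const (τ s α x)
    have h3 : (fun ρ => τ ρ α x) = fun r => τ (r - s) α (h s x) + τ s α x := by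
      funext r
      rw [← hcoc, sub_add_cancel]
    rw [h3]
    exact h2
  rw [intervalIntegral.integral_eq_sub_of_hasDerivAt (fun s _ => hd s)
    (hcont.intervalIntegrable 0 ρ), h0, sub_zero]
end
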